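/- Assume a ≥ 1 and let M be a Θ-invariant invertible n × n matrix over R whose (1,1) entry m₁₁ is a unit of R. Then there exists a Θ-invariant n × n matrix P over R[t], invertible in the ring of n × n matrices over R[t], such that P(0) = M and P(1) is the block diagonal matrix with (1,1) entry m₁₁ and lower-right (n−1) × (n−1) block M′, where M′ is an invertible (n−1) × (n−1) matrix over R that is invariant under the involution Θ′ on (n−1) × (n−1) matrices defined in the same way for the block sizes (a − 1, b). -/

import Mathlib

open Matrix Polynomial

/-- The block sign matrix `J` over `R` with first `a` diagonal entries `1` and the
remaining `b` diagonal entries `-1`. -/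
def blockJ (R : Type*) [CommRing R] (a b : ℕ) : Matrix (Fin (a + b)) (Fin (a + b)) R :=
  Matrix.diagonal fun i => if (i : ℕ) < a then (1 : R) else -1

/-- The involution `Θ(M) = J * σ(M) * J` on `n × n` matrices, where `σ` is applied
entrywise. -/
def Theta {R : Type*} [CommRing R] (σ : R →+* R) (a b : ℕ)
    (M : Matrix (Fin (a + b)) (Fin (a + b)) R) : Matrix (Fin (a + b)) (Fin (a + b)) R :=
  blockJ R a b * M.map σ * blockJ R a b

theorem Theta_apply {R : Type*} [CommRing R] (σ : R →+* R) (a b : ℕ)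
    (M : Matrix (Fin (a + b)) (Fin (a + b)) R) (i j : Fin (a + b)) :
    Theta σ a b M i j =
      (if (i : ℕ) < a then 1 else -1) * σ (M i j) * (if (j : ℕ) < a then 1 else -1) := by
  simp [Theta, blockJ, Matrix.mul_diagonal, Matrix.diagonal_mul]

/-- The determinant of a bordered matrix whose corner is a unit, via the Schur complement. -/
theorem Matrix.det_fromBlocks_corner {S ι : Type*} [CommRing S] [Fintype ι] [DecidableEq ι]
    (m u : S) (hmu : m * u = 1) (r : Matrix (Fin 1) ι S) (c : Matrix ι (Fin 1) S)
    (D : Matrix ι ι S) :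
    (fromBlocks (of fun _ _ => m) r c D).det =
      m * (of fun i j => D i j - c i 0 * u * r 0 j).det := by
  let A : Matrix (Fin 1) (Fin 1) S := of fun _ _ => m
  let : Invertible A :=
    ⟨of fun _ _ => u, by ext i j; fin_cases i; fin_cases j; simp [A, mul_apply, mul_comm u, hmu],
      by ext i j; fin_cases i; fin_cases j; simp [A, mul_apply, hmu]⟩
  have h := det_fromBlocks₁₁ A r c D
  rw [show A.det = m by simp [A]] at h
  refine h.trans ?_
  congr 2
  ext i j
  change (D - c * (of fun _ _ => u : Matrix (Fin 1) (Fin 1) S) * r : Matrix ι ι S) i j = _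
  simp [mul_apply]

/-- The straight-line deformation of the border of a block matrix to zero, corrected in the
lower-right block so that the Schur complement of the corner stays constant. -/
noncomputable def borderHomotopy {R ι : Type*} [CommRing R] (u : R)
    (N : Matrix (Fin 1 ⊕ ι) (Fin 1 ⊕ ι) R) : Matrix (Fin 1 ⊕ ι) (Fin 1 ⊕ ι) R[X] :=
  fromBlocks (of fun _ _ => C (N (.inl 0) (.inl 0)))
    (of fun _ j => (1 - X) * C (N (.inl 0) (.inr j)))
    (of fun i _ => (1 - X) * C (N (.inr i) (.inl 0)))
    (of fun i j => C (N (.inr i) (.inr j)) +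
      (X ^ 2 - 2 * X) * C (N (.inr i) (.inl 0) * u * N (.inl 0) (.inr j)))

/-- The Schur complement of the corner entry, whose inverse is `u`. -/
def cornerSchur {R ι : Type*} [CommRing R] (u : R)
    (N : Matrix (Fin 1 ⊕ ι) (Fin 1 ⊕ ι) R) : Matrix ι ι R :=
  of fun i j => N (.inr i) (.inr j) - N (.inr i) (.inl 0) * u * N (.inl 0) (.inr j)

section borderHomotopy

variable {R ι : Type*} [CommRing R] (u : R) (N : Matrix (Fin 1 ⊕ ι) (Fin 1 ⊕ ι) R)

theorem borderHomotopy_eval_zero : (borderHomotopy u N).map (evalRingHom (0 : R)) = N := by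
  ext (i | i) (j | j) <;> simp [borderHomotopy, Fin.eq_zero]

theorem borderHomotopy_eval_one : (borderHomotopy u N).map (evalRingHom (1 : R)) =
    fromBlocks (of fun _ _ => N (.inl 0) (.inl 0)) 0 0 (cornerSchur u N) := by
  ext (i | i) (j | j) <;> simp [borderHomotopy, cornerSchur]
  ring

variable [Fintype ι] [DecidableEq ι]

theorem det_eq_mul_det_cornerSchur (hu : N (.inl 0) (.inl 0) * u = 1) :
    N.det = N (.inl 0) (.inl 0) * (cornerSchur u N).det := by
  conv_lhs => rw [← fromBlocks_toBlocks N]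
  rw [show N.toBlocks₁₁ = of fun _ _ => N (.inl 0) (.inl 0) by
    ext i j; simp [toBlocks₁₁, Subsingleton.elim i 0, Subsingleton.elim j 0],
    det_fromBlocks_corner _ u hu]
  rfl

theorem det_borderHomotopy (hu : N (.inl 0) (.inl 0) * u = 1) :
    (borderHomotopy u N).det = C N.det := by
  rw [borderHomotopy, det_fromBlocks_corner _ (C u) (by rw [← C_mul, hu, C_1]),
    det_eq_mul_det_cornerSchur u N hu, C_mul, RingHom.map_det]
  congr 2
  ext1 i j
  simp only [cornerSchur, of_apply, RingHom.mapMatrix_apply, map_apply, C_mul, C_sub]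
  ring

end borderHomotopy

/-- Suppose `a ≥ 1` and `M` is a `Θ`-invariant invertible matrix whose `(1,1)` entry is a
unit. Then there is a `Θ`-invariant invertible matrix `P` over `R[t]` with `P(0) = M`
and `P(1)` the block diagonal matrix `diag(m₁₁, M′)`, with `M′` an invertible
`(n-1) × (n-1)` matrix invariant under the involution for block sizes `(a-1, b)`. -/
theorem stmt3 {R : Type*} [CommRing R] (σ : R →+* R) (hσ : Function.Involutive σ)
    (a b : ℕ) (ha : 1 ≤ a)
    (M : Matrix (Fin (a + b)) (Fin (a + b)) R)
    (hM : Theta σ a b M = M) (hMu : IsUnit M)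
    (hm : IsUnit (M ⟨0, by omega⟩ ⟨0, by omega⟩)) :
    ∃ (P : Matrix (Fin (a + b)) (Fin (a + b)) (Polynomial R))
      (M' : Matrix (Fin (a - 1 + b)) (Fin (a - 1 + b)) R),
      Theta (Polynomial.mapRingHom σ) a b P = P ∧
      IsUnit P ∧
      P.map (Polynomial.evalRingHom (0 : R)) = M ∧
      IsUnit M' ∧
      Theta σ (a - 1) b M' = M' ∧
      P.map (Polynomial.evalRingHom (1 : R)) =
        Matrix.submatrix
          (Matrix.fromBlocks
            (Matrix.of fun (_ : Fin 1) (_ : Fin 1) => M ⟨0, by omega⟩ ⟨0, by omega⟩) 0 0 M')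
          (fun i => finSumFinEquiv.symm (Fin.cast (by omega) i))
          (fun i => finSumFinEquiv.symm (Fin.cast (by omega) i)) := by
  obtain ⟨u, hu⟩ := hm.exists_right_inv
  let e : Fin 1 ⊕ Fin (a - 1 + b) ≃ Fin (a + b) :=
    finSumFinEquiv.trans (finCongr (by omega))
  have he0 : e (.inl 0) = ⟨0, by omega⟩ := by
    ext; simp [e]
  have hs0 : ((e (.inl 0) : Fin (a + b)) : ℕ) < a := by rw [he0]; exact ha
  have hs (i : Fin (a - 1 + b)) : ((e (.inr i) : Fin (a + b)) : ℕ) < a ↔ (i : ℕ) < a - 1 := by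
    simp [e]; omega
  let N : Matrix (Fin 1 ⊕ Fin (a - 1 + b)) (Fin 1 ⊕ Fin (a - 1 + b)) R := M.submatrix e e
  have hN00 : N (.inl 0) (.inl 0) = M ⟨0, by omega⟩ ⟨0, by omega⟩ := by simp [N, he0]
  rw [← hN00] at hu
  have hdet : IsUnit N.det := by
    rw [show N.det = M.det from det_submatrix_equiv_self e M]
    exact (isUnit_iff_isUnit_det M).1 hMu
  have hσN (x y) : (if (e x : ℕ) < a then 1 else -1) * σ (N x y) *
      (if (e y : ℕ) < a then 1 else -1) = N x y := by
    have h := Theta_apply σ a b M (e x) (e y)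
    rw [hM] at h
    exact h.symm
  have h00 : σ (N (.inl 0) (.inl 0)) = N (.inl 0) (.inl 0) := by
    simpa [hs0] using hσN (.inl 0) (.inl 0)
  have h01 (j) : σ (N (.inl 0) (.inr j)) =
      N (.inl 0) (.inr j) * (if (j : ℕ) < a - 1 then 1 else -1) := by
    conv_rhs => rw [← hσN (.inl 0) (.inr j)]
    simp only [hs0, hs]
    split_ifs <;> simp
  have h10 (i) : σ (N (.inr i) (.inl 0)) =
      N (.inr i) (.inl 0) * (if (i : ℕ) < a - 1 then 1 else -1) := by
    conv_rhs => rw [← hσN (.inr i) (.inl 0)]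
    simp only [hs0, hs]
    split_ifs <;> simp
  have h11 (i j) : σ (N (.inr i) (.inr j)) = (if (i : ℕ) < a - 1 then 1 else -1) *
      N (.inr i) (.inr j) * (if (j : ℕ) < a - 1 then 1 else -1) := by
    conv_rhs => rw [← hσN (.inr i) (.inr j)]
    simp only [hs]
    split_ifs <;> simp
  have hσu : σ u = u := by
    have h := congrArg σ hu
    rw [map_mul, h00, map_one] at h
    linear_combination u * h - σ u * hu
  refine ⟨(borderHomotopy u N).submatrix e.symm e.symm, cornerSchur u N, ?_, ?_, ?_, ?_, ?_, ?_⟩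
  · ext1 i j
    obtain ⟨x, rfl⟩ := e.surjective i
    obtain ⟨y, rfl⟩ := e.surjective j
    rw [Theta_apply]
    simp only [submatrix_apply, Equiv.symm_apply_apply]
    rcases x with x | x <;> rcases y with y | y <;>
      simp only [Fin.eq_zero, hs0, hs, borderHomotopy,
        fromBlocks_apply₁₁, fromBlocks_apply₁₂, fromBlocks_apply₂₁, fromBlocks_apply₂₂, of_apply,
        coe_mapRingHom, Polynomial.map_mul, Polynomial.map_add, Polynomial.map_sub,
        Polynomial.map_pow, Polynomial.map_one, Polynomial.map_ofNat, map_X, map_C, map_mul,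
        h00, h01, h10, h11, hσu] <;>
      split_ifs <;> simp <;> ring
  · rw [isUnit_iff_isUnit_det, det_submatrix_equiv_self, det_borderHomotopy u N hu]
    exact hdet.map C
  · rw [← submatrix_map, borderHomotopy_eval_zero]
    simp [N]
  · rw [isUnit_iff_isUnit_det]
    rw [det_eq_mul_det_cornerSchur u N hu] at hdet
    exact isUnit_of_mul_isUnit_right hdet
  · ext1 i j
    rw [Theta_apply]
    simp only [cornerSchur, of_apply, map_sub, map_mul, h01, h10, h11, hσu]
    split_ifs <;> ring
  · rw [← submatrix_map, borderHomotopy_eval_one, hN00]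
    rfl
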